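/- Special case (Markus–Kato): Let T be a self-adjoint operator with discrete spectrum on H whose eigenvalues λ_j are simple and satisfy λ_{j+1} − λ_j → ∞ as j → ∞. Then for any bounded operator B, the operator T + B has discrete spectrum and its root vectors form a Riesz basis of H. -/

import Mathlib

open Filter Topology
open scoped InnerProductSpace

section HilbertBasis

variable {H : Type*} [NormedAddCommGroup H] [InnerProductSpace ℂ H]

theorem HilbertBasis.eq_of_forall_inner_eq (e : HilbertBasis ℕ ℂ H) {x y : H}
    (h : ∀ k, ⟪e k, x⟫_ℂ = ⟪e k, y⟫_ℂ) : x = y := by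
  apply e.repr.injective
  ext k
  simpa only [e.repr_apply_apply] using h k

theorem HilbertBasis.inner_eq_ite (e : HilbertBasis ℕ ℂ H) (i j : ℕ) :
    ⟪e i, e j⟫_ℂ = if i = j then 1 else 0 :=
  orthonormal_iff_ite.mp e.orthonormal i j

theorem HilbertBasis.clm_eq_of_forall_inner_eq (e : HilbertBasis ℕ ℂ H) {Y Z : H →L[ℂ] H}
    (h : ∀ k j, ⟪e k, Y (e j)⟫_ℂ = ⟪e k, Z (e j)⟫_ℂ) : Y = Z := by
  refine ContinuousLinearMap.ext_on
    (Submodule.dense_iff_topologicalClosure_eq_top.mpr e.dense_span) ?_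
  rintro _ ⟨j, rfl⟩
  exact e.eq_of_forall_inner_eq fun k => h k j

theorem HilbertBasis.hasSum_norm_inner_sq (e : HilbertBasis ℕ ℂ H) (x : H) :
    HasSum (fun k => ‖⟪e k, x⟫_ℂ‖ ^ 2) (‖x‖ ^ 2) := by
  have h := (e.hasSum_inner_mul_inner x x).mapL Complex.reCLM
  convert! h using 1
  · ext k
    rw [← inner_conj_symm x (e k), mul_comm, Complex.mul_conj, Complex.normSq_eq_norm_sq]
    exact (Complex.ofReal_re _).symm
  · rw [inner_self_eq_norm_sq_to_K]
    norm_cast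

/-- A square-summable family of coordinate functionals assembles into a bounded operator. -/
theorem HilbertBasis.exists_clm_of_coordinates (e : HilbertBasis ℕ ℂ H) (φ : ℕ → H →ₗ[ℂ] ℂ)
    {C : ℝ} (hC : 0 ≤ C)
    (hφ : ∀ (x : H) (s : Finset ℕ), ∑ k ∈ s, ‖φ k x‖ ^ 2 ≤ (C * ‖x‖) ^ 2) :
    ∃ Z : H →L[ℂ] H, ‖Z‖ ≤ C ∧ ∀ k x, ⟪e k, Z x⟫_ℂ = φ k x := by
  have hmem : ∀ x, Memℓp (fun k => φ k x) 2 := fun x =>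
    memℓp_gen' (C := (C * ‖x‖) ^ 2) fun s => by simpa using hφ x s
  let Z : H →ₗ[ℂ] H :=
    { toFun := fun x => e.repr.symm ⟨fun k => φ k x, hmem x⟩
      map_add' := fun x y => by
        rw [← map_add]; congr 1; ext k; exact map_add _ _ _
      map_smul' := fun c x => by
        rw [RingHom.id_apply, ← map_smul]; congr 1; ext k; exact map_smul _ _ _ }
  refine ⟨Z.mkContinuous C fun x => ?_, LinearMap.mkContinuous_norm_le _ hC _, fun k x => ?_⟩
  · change ‖e.repr.symm _‖ ≤ _
    rw [LinearIsometryEquiv.norm_map]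
    refine lp.norm_le_of_forall_sum_le (by simp) (by positivity) fun s => ?_
    simpa using hφ x s
  · rw [← e.repr_apply_apply]
    change e.repr (e.repr.symm _) k = _
    rw [LinearIsometryEquiv.apply_symm_apply]

theorem HilbertBasis.exists_diagonal (e : HilbertBasis ℕ ℂ H) (a : ℕ → ℝ) {C : ℝ} (hC : 0 ≤ C)
    (ha : ∀ k, |a k| ≤ C) :
    ∃ Z : H →L[ℂ] H, ‖Z‖ ≤ C ∧ ∀ k x, ⟪e k, Z x⟫_ℂ = a k * ⟪e k, x⟫_ℂ := by
  obtain ⟨Z, hZ, hZe⟩ := e.exists_clm_of_coordinates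
    (fun k => (a k : ℂ) • (innerSL ℂ (e k)).toLinearMap) hC fun x s => by
      calc ∑ k ∈ s, ‖((a k : ℂ) • (innerSL ℂ (e k)).toLinearMap) x‖ ^ 2
          ≤ ∑ k ∈ s, C ^ 2 * ‖⟪e k, x⟫_ℂ‖ ^ 2 := by
            refine Finset.sum_le_sum fun k _ => ?_
            simp only [LinearMap.smul_apply, norm_smul, mul_pow, Complex.norm_real,
              Real.norm_eq_abs, ContinuousLinearMap.coe_coe, innerSL_apply_apply]
            gcongr
            exact ha k
        _ ≤ (C * ‖x‖) ^ 2 := by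
            rw [← Finset.mul_sum, mul_pow]
            gcongr
            exact e.orthonormal.sum_inner_products_le x
  exact ⟨Z, hZ, fun k x => by simp [hZe]⟩

/-- If the columns of the real matrix `s` are uniformly square-summable, then the entrywise product
of `s` with the matrix of a bounded operator is again bounded. -/
theorem HilbertBasis.exists_schur_product (e : HilbertBasis ℕ ℂ H) (s : ℕ → ℕ → ℝ) {C : ℝ}
    (hC : 0 ≤ C) (hs : ∀ (j : ℕ) (t : Finset ℕ), ∑ k ∈ t, s k j ^ 2 ≤ C ^ 2) (Y : H →L[ℂ] H) :
    ∃ Z : H →L[ℂ] H, ‖Z‖ ≤ C * ‖Y‖ ∧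
      ∀ k j, ⟪e k, Z (e j)⟫_ℂ = s k j * ⟪e k, Y (e j)⟫_ℂ := by
  have habs : ∀ k j, |s k j| ≤ C := fun k j =>
    abs_le_of_sq_le_sq (by simpa using hs j {k}) hC
  choose D hD hDe using fun k => e.exists_diagonal (s k) hC (habs k)
  have hnorm : ∀ k x, HasSum (fun j => s k j ^ 2 * ‖⟪e j, x⟫_ℂ‖ ^ 2) (‖D k x‖ ^ 2) := fun k x => by
    simpa [hDe, mul_pow] using e.hasSum_norm_inner_sq (D k x)
  obtain ⟨Z, hZ, hZe⟩ := e.exists_clm_of_coordinates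
    (fun k => (innerSL ℂ (e k) ∘L Y ∘L D k).toLinearMap) (C := C * ‖Y‖) (by positivity)
    fun x t => by
      calc ∑ k ∈ t, ‖(innerSL ℂ (e k) ∘L Y ∘L D k).toLinearMap x‖ ^ 2
          ≤ ∑ k ∈ t, ‖Y‖ ^ 2 * ‖D k x‖ ^ 2 := by
            refine Finset.sum_le_sum fun k _ => ?_
            rw [← mul_pow]
            gcongr
            calc ‖⟪e k, Y (D k x)⟫_ℂ‖ ≤ ‖e k‖ * ‖Y (D k x)‖ := norm_inner_le_norm _ _
              _ ≤ ‖Y‖ * ‖D k x‖ := by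
                rw [e.orthonormal.1 k, one_mul]
                exact Y.le_opNorm _
        _ = ‖Y‖ ^ 2 * ∑ k ∈ t, ‖D k x‖ ^ 2 := by rw [Finset.mul_sum]
        _ ≤ ‖Y‖ ^ 2 * (C ^ 2 * ‖x‖ ^ 2) := by
            gcongr
            refine hasSum_le (fun j => ?_) (hasSum_sum fun k _ => hnorm k x)
              ((e.hasSum_norm_inner_sq x).mul_left (C ^ 2))
            rw [← Finset.sum_mul]
            gcongr
            exact hs j t
        _ = (C * ‖Y‖ * ‖x‖) ^ 2 := by ring
  refine ⟨Z, hZ, fun k j => ?_⟩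
  have hDj : D k (e j) = (s k j : ℂ) • e j := e.eq_of_forall_inner_eq fun i => by
    rw [hDe, inner_smul_right, e.inner_eq_ite]
    split_ifs with h <;> simp [h]
  rw [hZe]
  change ⟪e k, Y (D k (e j))⟫_ℂ = _
  rw [hDj, map_smul, inner_smul_right]

/-- Entrywise multiplication by `s`, as a linear map on bounded operators. -/
theorem HilbertBasis.exists_schur_multiplier (e : HilbertBasis ℕ ℂ H) (s : ℕ → ℕ → ℝ) {C : ℝ}
    (hC : 0 ≤ C) (hs : ∀ (j : ℕ) (t : Finset ℕ), ∑ k ∈ t, s k j ^ 2 ≤ C ^ 2) :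
    ∃ S : (H →L[ℂ] H) →ₗ[ℂ] (H →L[ℂ] H), (∀ Y, ‖S Y‖ ≤ C * ‖Y‖) ∧
      ∀ Y k j, ⟪e k, S Y (e j)⟫_ℂ = s k j * ⟪e k, Y (e j)⟫_ℂ := by
  choose S hS hSe using e.exists_schur_product s hC hs
  refine ⟨⟨⟨S, fun Y Z => ?_⟩, fun c Y => ?_⟩, hS, hSe⟩
  · refine e.clm_eq_of_forall_inner_eq fun k j => ?_
    simp [hSe, mul_add]
  · refine e.clm_eq_of_forall_inner_eq fun k j => ?_
    simp [hSe, mul_left_comm]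

/-- The block-diagonal part of an operator, for the partition of the basis into the block
`{e 0, …, e (n - 1)}` and singletons. -/
theorem HilbertBasis.exists_blockDiagonal (e : HilbertBasis ℕ ℂ H) (n : ℕ) :
    ∃ Δ : (H →L[ℂ] H) →ₗ[ℂ] (H →L[ℂ] H), (∀ Y, ‖Δ Y‖ ≤ 2 * ‖Y‖) ∧
      ∀ Y k j, ⟪e k, Δ Y (e j)⟫_ℂ =
        if k = j ∨ (k < n ∧ j < n) then ⟪e k, Y (e j)⟫_ℂ else 0 := by
  obtain ⟨S, hS, hSe⟩ := e.exists_schur_multiplier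
    (fun k j => if k = j ∧ n ≤ k then 1 else 0) zero_le_one fun j t => by
      calc ∑ k ∈ t, (if k = j ∧ n ≤ k then (1 : ℝ) else 0) ^ 2
          ≤ ∑ k ∈ t, if k = j then (1 : ℝ) else 0 := by
            refine Finset.sum_le_sum fun k _ => ?_
            split_ifs <;> simp_all
        _ ≤ 1 ^ 2 := by
            rw [Finset.sum_ite_eq']
            split_ifs <;> simp
  obtain ⟨P, hP, hPe⟩ := e.exists_diagonal (fun k => if k < n then 1 else 0) zero_le_one
    fun k => by split_ifs <;> simp
  have hPj : ∀ j, P (e j) = if j < n then e j else 0 := fun j =>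
    e.eq_of_forall_inner_eq fun k => by
      rw [hPe]
      by_cases hk : k = j
      · subst hk; split_ifs <;> simp
      · split_ifs <;> simp [e.inner_eq_ite, hk]
  refine ⟨S + (LinearMap.mulLeft ℂ P ∘ₗ LinearMap.mulRight ℂ P), fun Y => ?_, fun Y k j => ?_⟩
  · calc ‖S Y + P * (Y * P)‖ ≤ ‖S Y‖ + ‖P‖ * (‖Y‖ * ‖P‖) :=
          norm_add_le_of_le le_rfl (norm_mul_le_of_le le_rfl (norm_mul_le Y P))
      _ ≤ 1 * ‖Y‖ + 1 * (‖Y‖ * 1) := by gcongr; exact hS Y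
      _ = 2 * ‖Y‖ := by ring
  · change ⟪e k, S Y (e j) + P (Y (P (e j)))⟫_ℂ = _
    rw [inner_add_right, hSe, hPe, hPj]
    rcases eq_or_ne k j with rfl | hkj
    · by_cases hk : k < n
      · simp [hk, Nat.not_le.mpr hk]
      · simp [hk, Nat.not_lt.mp hk]
    · by_cases hj : j < n <;> by_cases hk : k < n <;> simp [hj, hk, hkj]

end HilbertBasis

/-- A quadratic fixed-point equation in a Banach algebra, solved by contraction on the closed ball
of radius `1 / 2`. -/
theorem exists_norm_le_half_eq_map_mul_sub {E : Type*} [NormedRing E] [NormedSpace ℂ E]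
    [CompleteSpace E] (hone : ‖(1 : E)‖ ≤ 1) (S Δ : E →ₗ[ℂ] E) (b : E) {C : ℝ} (hC : 0 ≤ C)
    (hS : ∀ y, ‖S y‖ ≤ C * ‖y‖) (hΔ : ∀ y, ‖Δ y‖ ≤ 2 * ‖y‖) (hCb : C * ‖b‖ ≤ 1 / 10) :
    ∃ x : E, ‖x‖ ≤ 1 / 2 ∧ x = S (x * Δ (b * (1 + x)) - b * (1 + x)) := by
  have hone_add : ∀ x : E, ‖x‖ ≤ 1 / 2 → ‖b * (1 + x)‖ ≤ ‖b‖ * (3 / 2) := fun x hx =>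
    norm_mul_le_of_le le_rfl ((norm_add_le_of_le hone hx).trans (by norm_num))
  have hmaps : Set.MapsTo (fun x => S (x * Δ (b * (1 + x)) - b * (1 + x)))
      (Metric.closedBall (0 : E) (1 / 2)) (Metric.closedBall 0 (1 / 2)) := fun x hx => by
    rw [mem_closedBall_zero_iff] at hx ⊢
    calc ‖S (x * Δ (b * (1 + x)) - b * (1 + x))‖
        ≤ C * ‖x * Δ (b * (1 + x)) - b * (1 + x)‖ := hS _
      _ ≤ C * (1 / 2 * (2 * (‖b‖ * (3 / 2))) + ‖b‖ * (3 / 2)) := by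
          gcongr
          refine norm_sub_le_of_le (norm_mul_le_of_le hx ((hΔ _).trans ?_)) (hone_add x hx)
          gcongr
          exact hone_add x hx
      _ = 3 * (C * ‖b‖) := by ring
      _ ≤ 1 / 2 := by linarith
  have hcontr : ContractingWith (1 / 2) (hmaps.restrict _ _ _) := by
    refine ⟨by rw [← NNReal.coe_lt_coe]; norm_num, LipschitzWith.of_dist_le_mul ?_⟩
    rintro ⟨x, hx⟩ ⟨y, hy⟩
    rw [mem_closedBall_zero_iff] at hx hy
    simp only [Subtype.dist_eq, Set.MapsTo.val_restrict_apply, dist_eq_norm]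
    rw [← map_sub]
    have hsplit : x * Δ (b * (1 + x)) - b * (1 + x) - (y * Δ (b * (1 + y)) - b * (1 + y)) =
        (x - y) * Δ (b * (1 + x)) + y * Δ (b * (x - y)) - b * (x - y) := by
      have : b * (x - y) = b * (1 + x) - b * (1 + y) := by noncomm_ring
      rw [this, map_sub]
      noncomm_ring
    rw [hsplit]
    calc ‖S ((x - y) * Δ (b * (1 + x)) + y * Δ (b * (x - y)) - b * (x - y))‖
        ≤ C * (‖x - y‖ * (2 * (‖b‖ * (3 / 2))) + 1 / 2 * (2 * (‖b‖ * ‖x - y‖)) +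
            ‖b‖ * ‖x - y‖) := by
          refine (hS _).trans ?_
          gcongr
          refine norm_sub_le_of_le (norm_add_le_of_le
            (norm_mul_le_of_le le_rfl ((hΔ _).trans ?_))
            (norm_mul_le_of_le hy ((hΔ _).trans ?_))) (norm_mul_le _ _)
          · gcongr
            exact hone_add x hx
          · gcongr
            exact norm_mul_le _ _
      _ = 5 * (C * ‖b‖) * ‖x - y‖ := by ring
      _ ≤ ((1 / 2 : NNReal) : ℝ) * ‖x - y‖ := by
          gcongr
          push_cast
          linarith
  obtain ⟨x, hx, hfix, -⟩ := ContractingWith.exists_fixedPoint'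
    Metric.isClosed_closedBall.isComplete hmaps hcontr
    (Metric.mem_closedBall_self (by norm_num : (0 : ℝ) ≤ 1 / 2)) (edist_ne_top _ _)
  exact ⟨x, mem_closedBall_zero_iff.mp hx, hfix.symm⟩

theorem mul_sub_le_of_forall_le_succ_sub {lam : ℕ → ℝ} {d : ℝ} {m : ℕ}
    (h : ∀ k ≥ m, d ≤ lam (k + 1) - lam k) {i j : ℕ} (hi : m ≤ i) (hij : i ≤ j) :
    d * ((j : ℝ) - i) ≤ lam j - lam i := by
  induction j, hij using Nat.le_induction with
  | base => simp
  | succ j hj ih =>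
    have := h j (hi.trans hj)
    push_cast
    linarith

theorem tendsto_atTop_of_gap {lam : ℕ → ℝ}
    (hgap : Tendsto (fun j => lam (j + 1) - lam j) atTop atTop) : Tendsto lam atTop atTop := by
  obtain ⟨m, hm⟩ := eventually_atTop.mp (hgap.eventually_ge_atTop 1)
  have hlin : Tendsto (fun j : ℕ => (j : ℝ) + (lam m - m)) atTop atTop :=
    tendsto_atTop_add_const_right _ _ tendsto_natCast_atTop_atTop
  refine tendsto_atTop_mono' _ ?_ hlin
  filter_upwards [eventually_ge_atTop m] with j hj
  have := mul_sub_le_of_forall_le_succ_sub hm le_rfl hj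
  linarith

/-- If the gaps of `lam` tend to infinity, then the sums of the squared inverse distances
from `lam j` to the other values tend to zero as `j → ∞`. -/
theorem exists_forall_sum_inv_sq_le {lam : ℕ → ℝ} (hmono : StrictMono lam)
    (hgap : Tendsto (fun j => lam (j + 1) - lam j) atTop atTop) {ε : ℝ} (hε : 0 < ε) :
    ∃ m : ℕ, ∀ j ≥ m, ∀ t : Finset ℕ, ∑ k ∈ t, (lam k - lam j)⁻¹ ^ 2 ≤ ε := by
  have hsum : Summable fun i : ℤ => 1 / (i : ℝ) ^ 2 :=
    Real.summable_one_div_int_pow.mpr one_lt_two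
  set Z : ℝ := ∑' i : ℤ, 1 / (i : ℝ) ^ 2
  have hZ : 0 ≤ Z := tsum_nonneg fun i => by positivity
  have hinv : ∀ c : ℝ, 0 ≤ c → ∃ d : ℝ, 0 < d ∧ d⁻¹ ^ 2 * c ≤ ε / 2 := fun c hc => by
    refine ⟨max 1 (2 * c / ε), by positivity, ?_⟩
    set d := max 1 (2 * c / ε)
    have h1 : 1 ≤ d := le_max_left _ _
    have h2 : 2 * c / ε ≤ d := le_max_right _ _
    rw [div_le_iff₀ hε] at h2
    rw [inv_pow, inv_mul_le_iff₀ (by positivity)]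
    nlinarith [mul_le_mul_of_nonneg_right h1 (by positivity : 0 ≤ d * ε)]
  obtain ⟨d, hd, hdZ⟩ := hinv Z hZ
  obtain ⟨m₀, hm₀⟩ := eventually_atTop.mp (hgap.eventually_ge_atTop d)
  obtain ⟨r, hr, hrm⟩ := hinv m₀ (Nat.cast_nonneg _)
  obtain ⟨m, hm⟩ := eventually_atTop.mp
    ((eventually_ge_atTop m₀).and ((tendsto_atTop_of_gap hgap).eventually_ge_atTop (lam m₀ + r)))
  refine ⟨m, fun j hj t => ?_⟩
  obtain ⟨hjm, hjr⟩ := hm j hj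
  have hterm : ∀ k, (lam k - lam j)⁻¹ ^ 2 ≤
      d⁻¹ ^ 2 * (1 / (((k : ℤ) - j : ℤ) : ℝ) ^ 2) + if k < m₀ then r⁻¹ ^ 2 else 0 := fun k => by
    split_ifs with hk
    · have hlt : lam k < lam m₀ := hmono hk
      rw [← neg_sub, inv_neg, neg_sq]
      have : (lam j - lam k)⁻¹ ^ 2 ≤ r⁻¹ ^ 2 := by
        gcongr
        · exact inv_nonneg.mpr (by linarith)
        · linarith
      have : 0 ≤ d⁻¹ ^ 2 * (1 / (((k : ℤ) - j : ℤ) : ℝ) ^ 2) := by positivity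
      linarith
    · push Not at hk
      rw [add_zero, one_div, ← inv_pow, ← mul_pow, ← mul_inv]
      push_cast
      rcases lt_trichotomy k j with hkj | rfl | hkj
      · have h := mul_sub_le_of_forall_le_succ_sub hm₀ hk hkj.le
        have hpos : (0 : ℝ) < (j : ℝ) - k := sub_pos.mpr (Nat.cast_lt.mpr hkj)
        rw [← neg_sub (lam j), ← neg_sub (j : ℝ), mul_neg, inv_neg, inv_neg, neg_sq, neg_sq]
        gcongr
        exact inv_nonneg.mpr (le_trans (by positivity) h)
      · simp
      · have h := mul_sub_le_of_forall_le_succ_sub hm₀ hjm hkj.le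
        have hpos : (0 : ℝ) < (k : ℝ) - j := sub_pos.mpr (Nat.cast_lt.mpr hkj)
        gcongr
        exact inv_nonneg.mpr (le_trans (by positivity) h)
  calc ∑ k ∈ t, (lam k - lam j)⁻¹ ^ 2
      ≤ ∑ k ∈ t, (d⁻¹ ^ 2 * (1 / (((k : ℤ) - j : ℤ) : ℝ) ^ 2) +
          if k < m₀ then r⁻¹ ^ 2 else 0) := Finset.sum_le_sum fun k _ => hterm k
    _ = d⁻¹ ^ 2 * (∑ k ∈ t, 1 / (((k : ℤ) - j : ℤ) : ℝ) ^ 2) +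
          (t.filter (· < m₀)).card * r⁻¹ ^ 2 := by
        rw [Finset.sum_add_distrib, Finset.mul_sum, ← Finset.sum_filter, Finset.sum_const,
          nsmul_eq_mul]
    _ ≤ d⁻¹ ^ 2 * Z + m₀ * r⁻¹ ^ 2 := by
        gcongr
        · have hinj : Function.Injective fun k : ℕ => (k : ℤ) - j := fun a b h => by
            simpa using h
          have h := hsum.sum_le_tsum (t.map ⟨_, hinj⟩) fun i _ => by positivity
          rwa [Finset.sum_map] at h
        · calc (t.filter (· < m₀)).card ≤ (Finset.range m₀).card :=
                Finset.card_le_card fun k hk => by simpa using (Finset.mem_filter.mp hk).2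
            _ = m₀ := Finset.card_range _
    _ ≤ ε := by linarith

/-- Over `ℂ`, every endomorphism of `Fin n → ℂ` has a basis of generalized eigenvectors. -/
theorem Module.End.exists_basis_maxGenEigenspace {n : ℕ} (L : Module.End ℂ (Fin n → ℂ)) :
    ∃ (b : Module.Basis (Fin n) ℂ (Fin n → ℂ)) (ν : Fin n → ℂ),
      ∀ i, b i ∈ L.maxGenEigenspace (ν i) := by
  have hspan : ⊤ ≤ Submodule.span ℂ (⋃ μ, (L.maxGenEigenspace μ : Set (Fin n → ℂ))) := by
    rw [← Module.End.iSup_maxGenEigenspace_eq_top L, Submodule.iSup_eq_span]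
  have hmem : ∀ i, ∃ μ, Module.Basis.ofSpan hspan i ∈ L.maxGenEigenspace μ := fun i => by
    simpa using Module.Basis.ofSpan_subset hspan (Set.mem_range_self i)
  choose ν hν using hmem
  let σ := (Module.Basis.ofSpan hspan).indexEquiv (Pi.basisFun ℂ (Fin n))
  exact ⟨(Module.Basis.ofSpan hspan).reindex σ, fun i => ν (σ.symm i), fun i => by
    simpa using hν (σ.symm i)⟩

section Perturbation

variable {H : Type*} [NormedAddCommGroup H] [InnerProductSpace ℂ H]

/-- The graph of `T + B`, where `T` is the self-adjoint operator with eigenbasis `e` and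
eigenvalues `lam`, described by coordinates with respect to `e`. -/
def HilbertBasis.perturbedGraph (e : HilbertBasis ℕ ℂ H) (lam : ℕ → ℝ) (B : H →L[ℂ] H) :
    Submodule ℂ (H × H) where
  carrier := {p | ∀ j, ⟪e j, p.2⟫_ℂ = (lam j : ℂ) * ⟪e j, p.1⟫_ℂ + ⟪e j, B p.1⟫_ℂ}
  add_mem' {p q} hp hq j := by
    simp only [Prod.fst_add, Prod.snd_add, map_add, inner_add_right, hp j, hq j]
    ring
  zero_mem' j := by simp
  smul_mem' c p hp j := by
    simp only [Prod.smul_fst, Prod.smul_snd, map_smul, inner_smul_right, hp j]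
    ring

theorem HilbertBasis.mem_perturbedGraph {e : HilbertBasis ℕ ℂ H} {lam : ℕ → ℝ} {B : H →L[ℂ] H}
    {x y : H} : (x, y) ∈ e.perturbedGraph lam B ↔
      ∀ j, ⟪e j, y⟫_ℂ = (lam j : ℂ) * ⟪e j, x⟫_ℂ + ⟪e j, B x⟫_ℂ :=
  Iff.rfl

/-- A vector whose coordinates vanish outside `s` is the sum of its coordinates over `s`. -/
theorem HilbertBasis.eq_sum_of_inner_eq_zero (e : HilbertBasis ℕ ℂ H) {x : H} {s : Finset ℕ}
    (h : ∀ k ∉ s, ⟪e k, x⟫_ℂ = 0) : x = ∑ i ∈ s, ⟪e i, x⟫_ℂ • e i := by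
  refine e.eq_of_forall_inner_eq fun k => ?_
  simp only [inner_sum, inner_smul_right, e.inner_eq_ite, mul_ite, mul_one, mul_zero,
    Finset.sum_ite_eq]
  split_ifs with hk
  · rfl
  · exact h k hk

/-- `T + B` is similar to an operator `T + D` with `D` bounded and block-diagonal, where all blocks
but the first one have size one. -/
theorem HilbertBasis.exists_similar_blockDiagonal [CompleteSpace H] (e : HilbertBasis ℕ ℂ H)
    {lam : ℕ → ℝ} (hmono : StrictMono lam)
    (hgap : Tendsto (fun j => lam (j + 1) - lam j) atTop atTop) (B : H →L[ℂ] H) :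
    ∃ (n : ℕ) (F : (H →L[ℂ] H)ˣ) (D : H →L[ℂ] H),
      (∀ k j, ¬(k = j ∨ (k < n ∧ j < n)) → ⟪e k, D (e j)⟫_ℂ = 0) ∧
      ∀ j, ((F : H →L[ℂ] H) (e j), (F : H →L[ℂ] H) ((lam j : ℂ) • e j + D (e j))) ∈
        e.perturbedGraph lam B := by
  set C : ℝ := (10 * (‖B‖ + 1))⁻¹ with hCdef
  have hC : 0 < C := by positivity
  have hCB : C * ‖B‖ ≤ 1 / 10 := by
    rw [hCdef, inv_mul_le_iff₀ (by positivity)]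
    linarith
  obtain ⟨m, hm⟩ := exists_forall_sum_inv_sq_le hmono hgap (pow_pos hC 2)
  obtain ⟨S, hS, hSe⟩ := e.exists_schur_multiplier
    (fun k j => if k < m + 1 ∧ j < m + 1 then 0 else (lam k - lam j)⁻¹) hC.le fun j t => by
      refine le_trans (Finset.sum_le_sum fun k _ => ?_) (hm (max j m) (le_max_right _ _) t)
      split_ifs with h
      · rw [zero_pow two_ne_zero]
        positivity
      · rcases le_total m j with hj | hj
        · rw [max_eq_left hj]
        · rw [max_eq_right hj]
          have hk : m < k := by omega
          have h1 : lam m < lam k := hmono hk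
          have h2 : lam j ≤ lam m := hmono.monotone hj
          gcongr
          exact inv_nonneg.mpr (by linarith)
  obtain ⟨Δ, hΔ, hΔe⟩ := e.exists_blockDiagonal (m + 1)
  obtain ⟨X, hX, hfix⟩ := exists_norm_le_half_eq_map_mul_sub ContinuousLinearMap.norm_id_le
    S Δ B hC.le hS hΔ hCB
  set D := Δ (B * (1 + X)) with hD
  have hDe : ∀ k j, ⟪e k, D (e j)⟫_ℂ =
      if k = j ∨ (k < m + 1 ∧ j < m + 1) then ⟪e k, (B * (1 + X)) (e j)⟫_ℂ else 0 :=
    fun k j => hΔe _ k j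
  have hD0 : ∀ k j, ¬(k = j ∨ (k < m + 1 ∧ j < m + 1)) → ⟪e k, D (e j)⟫_ℂ = 0 :=
    fun k j h => by rw [hDe, if_neg h]
  have hXe : ∀ k j, ⟪e k, X (e j)⟫_ℂ =
      ((if k < m + 1 ∧ j < m + 1 then 0 else (lam k - lam j)⁻¹ : ℝ) : ℂ) *
        ⟪e k, (X * D - B * (1 + X)) (e j)⟫_ℂ := fun k j => by
    rw [← hSe, ← hfix]
  have hX0 : ∀ k j, (k = j ∨ (k < m + 1 ∧ j < m + 1)) → ⟪e k, X (e j)⟫_ℂ = 0 := fun k j h => by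
    rw [hXe]
    rcases h with rfl | h
    · simp
    · simp [h]
  have hXD0 : ∀ k j, (k = j ∨ (k < m + 1 ∧ j < m + 1)) → ⟪e k, X (D (e j))⟫_ℂ = 0 :=
    fun k j h => by
      rw [e.eq_sum_of_inner_eq_zero (x := D (e j)) (s := Finset.range (j + m + 1)) fun i hi =>
        hD0 i j (by rw [Finset.mem_range] at hi; omega), map_sum, inner_sum]
      refine Finset.sum_eq_zero fun i _ => ?_
      rw [map_smul, inner_smul_right]
      by_cases hij : i = j ∨ (i < m + 1 ∧ j < m + 1)
      · rw [hX0 k i (by omega), mul_zero]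
      · rw [hD0 i j hij, zero_mul]
  have hunit : IsUnit (1 + X) := by
    simpa using isUnit_one_sub_of_norm_lt_one (x := -X) (by rw [norm_neg]; linarith)
  obtain ⟨F, hF⟩ := hunit
  refine ⟨m + 1, F, D, hD0, fun j => ?_⟩
  rw [hF, e.mem_perturbedGraph]
  intro k
  have hexp : ∀ x, (1 + X) x = x + X x := fun x => rfl
  have hB : B ((1 + X) (e j)) = (B * (1 + X)) (e j) := rfl
  rw [hB]
  simp only [hexp, map_add, map_smul, inner_add_right, inner_smul_right]
  by_cases h : k = j ∨ (k < m + 1 ∧ j < m + 1)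
  · rw [hX0 k j h, hXD0 k j h, hDe, if_pos h, e.inner_eq_ite]
    split_ifs with hkj
    · rw [hkj]; ring
    · ring
  · have hkj : k ≠ j := fun hkj => h (Or.inl hkj)
    have hne : (lam k : ℂ) - lam j ≠ 0 := by
      rw [sub_ne_zero]
      exact_mod_cast hmono.injective.ne hkj
    have hval : ((lam k : ℂ) - lam j) * ⟪e k, X (e j)⟫_ℂ =
        ⟪e k, X (D (e j))⟫_ℂ - ⟪e k, (B * (1 + X)) (e j)⟫_ℂ := by
      rw [hXe, if_neg fun hh => h (Or.inr hh)]
      push_cast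
      rw [mul_inv_cancel_left₀ hne, ← inner_sub_right]
      rfl
    rw [hD0 k j h, e.inner_eq_ite, if_neg hkj]
    linear_combination -hval

/-- A bounded invertible operator replacing the vectors `e 0, …, e (n - 1)` by the combinations
given by a basis of `Fin n → ℂ`, and fixing the other vectors of `e`. -/
theorem HilbertBasis.exists_units_head (e : HilbertBasis ℕ ℂ H) {n : ℕ}
    (b : Module.Basis (Fin n) ℂ (Fin n → ℂ)) :
    ∃ G : (H →L[ℂ] H)ˣ, ∀ k, (G : H →L[ℂ] H) (e k) =
      if h : k < n then ∑ i : Fin n, b ⟨k, h⟩ i • e i else e k := by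
  let J : (Fin n → ℂ) →L[ℂ] H :=
    (Fintype.linearCombination ℂ (fun i : Fin n => e i)).toContinuousLinearMap
  have hJ : ∀ c, J c = ∑ i : Fin n, c i • e i := fun c => Fintype.linearCombination_apply ..
  let R : H →L[ℂ] (Fin n → ℂ) := ContinuousLinearMap.pi fun i => innerSL ℂ (e i)
  have hR : ∀ x i, R x i = ⟪e i, x⟫_ℂ := fun x i => rfl
  have hRJ : ∀ c, R (J c) = c := fun c => by
    ext i
    simp [hR, hJ, e.inner_eq_ite, Fin.val_inj]
  let β := (Pi.basisFun ℂ (Fin n)).equiv b (Equiv.refl _)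
  let U : ((Fin n → ℂ) ≃ₗ[ℂ] (Fin n → ℂ)) → H →L[ℂ] H := fun γ =>
    1 + J ∘L (γ.toLinearMap.toContinuousLinearMap - 1) ∘L R
  have hU : ∀ γ x, U γ x = x + J (γ (R x) - R x) := fun γ x => rfl
  have hUU : ∀ γ δ : (Fin n → ℂ) ≃ₗ[ℂ] (Fin n → ℂ), (∀ c, γ (δ c) = c) → U γ * U δ = 1 :=
    fun γ δ hγδ => by
      ext x
      change U γ (U δ x) = x
      simp only [hU, map_add, map_sub, hRJ, hγδ]
      abel
  refine ⟨⟨U β, U β.symm, hUU _ _ β.apply_symm_apply, hUU _ _ β.symm_apply_apply⟩, fun k => ?_⟩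
  change U β (e k) = _
  rw [hU]
  split_ifs with h
  · have hRk : R (e k) = Pi.basisFun ℂ (Fin n) ⟨k, h⟩ := by
      ext i
      simp [hR, e.inner_eq_ite, Pi.single_apply, Fin.ext_iff]
    have hJk : J (Pi.basisFun ℂ (Fin n) ⟨k, h⟩) = e k := by
      simp [hJ, Pi.single_apply]
    rw [hRk, Module.Basis.equiv_apply, Equiv.refl_apply, map_sub, hJk, hJ]
    abel
  · have hRk : R (e k) = 0 := by
      ext i
      rw [hR, e.inner_eq_ite, if_neg (by omega), Pi.zero_apply]
    simp [hRk]

/-- A vector of a generalized eigenspace is the end of a Jordan chain. -/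
theorem Module.End.exists_chain_of_mem_maxGenEigenspace {V : Type*} [AddCommGroup V] [Module ℂ V]
    {L : Module.End ℂ V} {ν : ℂ} {v : V} (hv : v ∈ L.maxGenEigenspace ν) :
    ∃ (m : ℕ) (g : ℕ → V), g 0 = 0 ∧ g (m + 1) = v ∧
      ∀ i ≤ m, ν • g (i + 1) + g i = L (g (i + 1)) := by
  obtain ⟨p, hp⟩ := (Module.End.mem_maxGenEigenspace L ν v).mp hv
  refine ⟨p, fun i => ((L - ν • 1) ^ (p + 1 - i)) v, ?_, by simp, fun i hi => ?_⟩
  · simp [pow_succ', hp]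
  · have : p + 1 - i = (p + 1 - (i + 1)) + 1 := by omega
    simp only
    rw [this, pow_succ']
    simp

end Perturbation

/-- **Markus–Kato.** Let `T` be a self-adjoint operator with discrete spectrum
whose eigenvalues `λ_j` are simple and satisfy `λ_{j+1} − λ_j → ∞`.  (We encode `T` by an
orthonormal Hilbert basis `e` of eigenvectors and the eigenvalue sequence `lam`; the action of
`A = T + B` is encoded weakly: `A x = y` iff `⟪e_j, y⟫ = λ_j ⟪e_j, x⟫ + ⟪e_j, B x⟫` for all
`j`.)  Then for any bounded operator `B`, the operator `T + B` has discrete spectrum (its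
eigenvalues escape to infinity) and its root vectors (generalized eigenvectors) form a Riesz
basis of `H`, i.e. the image of an orthonormal basis under a bounded invertible operator. -/
theorem markus_kato_riesz_basis_of_root_vectors
    {H : Type*} [NormedAddCommGroup H] [InnerProductSpace ℂ H] [CompleteSpace H]
    (e : HilbertBasis ℕ ℂ H) (lam : ℕ → ℝ)
    (hmono : StrictMono lam)
    (hgap : Tendsto (fun j => lam (j + 1) - lam j) atTop atTop)
    (B : H →L[ℂ] H) :
    ∃ (f : ℕ → H) (μ : ℕ → ℂ),
      -- `f` is a Riesz basis of `H`:
      (∃ (K : (H →L[ℂ] H)ˣ) (o : HilbertBasis ℕ ℂ H),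
        ∀ k, f k = (K : H →L[ℂ] H) (o k)) ∧
      -- each `f k` is a root vector of `A = T + B` with eigenvalue `μ k`:
      (∀ k, ∃ (m : ℕ) (g : ℕ → H), g 0 = 0 ∧ g (m + 1) = f k ∧
        ∀ i ≤ m, ∀ j : ℕ,
          ⟪e j, (μ k • g (i + 1) + g i : H)⟫_ℂ
            = (lam j : ℂ) * ⟪e j, g (i + 1)⟫_ℂ + ⟪e j, B (g (i + 1))⟫_ℂ) ∧
      -- discreteness of the spectrum of `T + B`: the eigenvalues escape to infinity
      Tendsto (fun k => ‖μ k‖) atTop atTop := by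
  obtain ⟨n, F, D, hD, hFD⟩ := e.exists_similar_blockDiagonal hmono hgap B
  let J : (Fin n → ℂ) →ₗ[ℂ] H := Fintype.linearCombination ℂ (fun i : Fin n => e i)
  have hJ : ∀ c, J c = ∑ i : Fin n, c i • e i := fun c => Fintype.linearCombination_apply ..
  let L : Module.End ℂ (Fin n → ℂ) :=
    LinearMap.pi fun i => (lam i : ℂ) • LinearMap.proj i +
      (innerSL ℂ (e i)).toLinearMap ∘ₗ D.toLinearMap ∘ₗ J
  have hL : ∀ c i, L c i = lam i * c i + ⟪e i, D (J c)⟫_ℂ := fun c i => rfl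
  have hDJ : ∀ c, D (J c) = ∑ i : Fin n, ⟪e i, D (J c)⟫_ℂ • e i := fun c => by
    rw [Fin.sum_univ_eq_sum_range (fun i => ⟪e i, D (J c)⟫_ℂ • e i)]
    refine e.eq_sum_of_inner_eq_zero fun k hk => ?_
    rw [hJ, map_sum, inner_sum]
    refine Finset.sum_eq_zero fun i _ => ?_
    rw [Finset.mem_range] at hk
    rw [map_smul, inner_smul_right, hD k i (by omega), mul_zero]
  have hhead : ∀ c, ((F : H →L[ℂ] H) (J c), (F : H →L[ℂ] H) (J (L c))) ∈
      e.perturbedGraph lam B := fun c => by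
    have h := Submodule.sum_mem (e.perturbedGraph lam B) (t := Finset.univ)
      fun (i : Fin n) _ => Submodule.smul_mem _ (c i) (hFD i)
    have hJL : J (L c) = ∑ i : Fin n, c i • ((lam i : ℂ) • e i + D (e i)) := by
      simp only [smul_add, Finset.sum_add_distrib]
      rw [hJ]
      simp only [hL, add_smul, Finset.sum_add_distrib]
      rw [← hDJ]
      simp only [hJ, map_sum, map_smul, smul_smul, mul_comm]
    convert! h using 1
    rw [hJL, hJ]
    simp only [map_sum, map_smul]
    ext <;> simp [Prod.fst_sum, Prod.snd_sum]
  obtain ⟨b, ν, hb⟩ := L.exists_basis_maxGenEigenspace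
  obtain ⟨G, hG⟩ := e.exists_units_head b
  refine ⟨fun k => (F : H →L[ℂ] H) ((G : H →L[ℂ] H) (e k)),
    fun k => if h : k < n then ν ⟨k, h⟩ else lam k + ⟪e k, D (e k)⟫_ℂ,
    ⟨F * G, e, fun k => rfl⟩, fun k => ?_, ?_⟩
  · by_cases hk : k < n
    · obtain ⟨m, g, hg0, hgm, hg⟩ :=
        Module.End.exists_chain_of_mem_maxGenEigenspace (hb ⟨k, hk⟩)
      refine ⟨m, fun i => (F : H →L[ℂ] H) (J (g i)), by simp [hg0], ?_, fun i hi => ?_⟩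
      · simp only
        rw [hgm, hG, dif_pos hk, hJ]
      · simp only
        rw [dif_pos hk, ← map_smul, ← map_smul, ← map_add, ← map_add, hg i hi]
        exact e.mem_perturbedGraph.mp (hhead _)
    · refine ⟨0, fun i => if i = 0 then 0 else (F : H →L[ℂ] H) (e k), by simp,
        by simp [hG, hk], fun i hi => ?_⟩
      obtain rfl : i = 0 := by omega
      have hDk : D (e k) = ⟪e k, D (e k)⟫_ℂ • e k := by
        simpa using e.eq_sum_of_inner_eq_zero (x := D (e k)) (s := {k}) fun i hi =>
          hD i k (by rw [Finset.mem_singleton] at hi; omega)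
      have h := hFD k
      rw [hDk, ← add_smul, map_smul] at h
      simpa [hk] using e.mem_perturbedGraph.mp h
  · refine tendsto_atTop_mono' _ ?_
      (tendsto_atTop_add_const_right _ (-‖D‖) (tendsto_atTop_of_gap hgap))
    filter_upwards [eventually_ge_atTop n] with k hk
    rw [dif_neg (by omega)]
    have h1 : ‖⟪e k, D (e k)⟫_ℂ‖ ≤ ‖D‖ := by
      refine (norm_inner_le_norm _ _).trans ?_
      simpa [e.orthonormal.1 k] using D.le_opNorm (e k)
    have h2 : lam k ≤ ‖(lam k : ℂ)‖ := by
      rw [Complex.norm_real]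
      exact le_abs_self _
    have h3 := norm_sub_le_norm_add (lam k : ℂ) ⟪e k, D (e k)⟫_ℂ
    linarith
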